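/- The non-isomorphic graphs C₆ and C₃ ⊔ C₃ cannot be distinguished by any MPGNN without positional encodings: for every representation type X, every constant initial representation h⁰(v) = c ∈ X on all vertices of both graphs, every choice of update functions f₁,…,f_n, and every pooling function F on multisets of representations, the multisets of node representations of C₆ and C₃ ⊔ C₃ are equal at every layer, and hence the pooled graph representations F({{h(v)}}) of the two graphs are equal. -/

import Mathlib

open SimpleGraph

instance {α β : Type*} (G : SimpleGraph α) (H : SimpleGraph β)
    [DecidableRel G.Adj] [DecidableRel H.Adj] : DecidableRel (G ⊕g H).Adj
  | Sum.inl a, Sum.inl b => decidable_of_iff (G.Adj a b) (by simp)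
  | Sum.inl _, Sum.inr _ => Decidable.isFalse (by simp)
  | Sum.inr _, Sum.inl _ => Decidable.isFalse (by simp)
  | Sum.inr a, Sum.inr b => decidable_of_iff (H.Adj a b) (by simp)

/-- A message-passing GNN: `mpgnn G h0 f ℓ v` is the layer-`ℓ` representation `h^ℓ(v)`,
with initial representation `h0` and update functions `f ℓ`, where layer `ℓ ≥ 1` applies
`f ℓ` to the previous representation of `v` and the multiset of previous representations
of the neighbors of `v`. -/
def mpgnn {V X : Type*} [Fintype V] (G : SimpleGraph V) [DecidableRel G.Adj]
    (h0 : V → X) (f : ℕ → X × Multiset X → X) : ℕ → V → X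
  | 0 => h0
  | ℓ + 1 => fun v =>
      f (ℓ + 1) (mpgnn G h0 f ℓ v, (G.neighborFinset v).val.map (mpgnn G h0 f ℓ))

/-- The representation shared by all vertices of a `d`-regular graph after `ℓ` layers of message
passing from the constant initial representation `c`. -/
def regularRepr {X : Type*} (d : ℕ) (c : X) (f : ℕ → X × Multiset X → X) : ℕ → X
  | 0 => c
  | ℓ + 1 => f (ℓ + 1) (regularRepr d c f ℓ, Multiset.replicate d (regularRepr d c f ℓ))

theorem mpgnn_const_of_isRegularOfDegree {V X : Type*} [Fintype V] {G : SimpleGraph V}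
    [DecidableRel G.Adj] [G.LocallyFinite] {d : ℕ} (hG : G.IsRegularOfDegree d) (c : X)
    (f : ℕ → X × Multiset X → X) (ℓ : ℕ) :
    mpgnn G (fun _ => c) f ℓ = fun _ => regularRepr d c f ℓ := by
  induction ℓ with
  | zero => rfl
  | succ ℓ ih =>
    funext v
    simp only [mpgnn, regularRepr, ih, Multiset.map_const', Finset.card_val]
    congr!
    rw [← hG v, SimpleGraph.degree]
    congr!

theorem map_mpgnn_eq_of_isRegularOfDegree {V W X : Type*} [Fintype V] [Fintype W]
    {G : SimpleGraph V} {H : SimpleGraph W} [DecidableRel G.Adj] [DecidableRel H.Adj]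
    [G.LocallyFinite] [H.LocallyFinite] {d : ℕ}
    (hG : G.IsRegularOfDegree d) (hH : H.IsRegularOfDegree d)
    (hcard : Fintype.card V = Fintype.card W) (c : X) (f : ℕ → X × Multiset X → X) (ℓ : ℕ) :
    (Finset.univ : Finset V).val.map (mpgnn G (fun _ => c) f ℓ) =
      (Finset.univ : Finset W).val.map (mpgnn H (fun _ => c) f ℓ) := by
  rw [mpgnn_const_of_isRegularOfDegree hG, mpgnn_const_of_isRegularOfDegree hH,
    Multiset.map_const', Multiset.map_const', Finset.card_val, Finset.card_val,
    Finset.card_univ, Finset.card_univ, hcard]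

theorem isRegularOfDegree_cycleGraph (n : ℕ) : (cycleGraph (n + 3)).IsRegularOfDegree 2 :=
  fun _ => cycleGraph_degree_three_le

theorem isRegularOfDegree_sum {V W : Type*} {G : SimpleGraph V} {H : SimpleGraph W}
    [G.LocallyFinite] [H.LocallyFinite] [(G ⊕g H).LocallyFinite] {d : ℕ}
    (hG : G.IsRegularOfDegree d) (hH : H.IsRegularOfDegree d) :
    (G ⊕g H).IsRegularOfDegree d := by
  rintro (v | w)
  · rw [← hG v, ← card_neighborSet_eq_degree, ← card_neighborSet_eq_degree,
      ← Nat.card_eq_fintype_card, ← Nat.card_eq_fintype_card, neighborSet_sum_inl,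
      Nat.card_image_of_injective Sum.inl_injective]
  · rw [← hH w, ← card_neighborSet_eq_degree, ← card_neighborSet_eq_degree,
      ← Nat.card_eq_fintype_card, ← Nat.card_eq_fintype_card, neighborSet_sum_inr,
      Nat.card_image_of_injective Sum.inr_injective]

/-- The non-isomorphic graphs `C₆` and `C₃ ⊔ C₃` cannot be distinguished by
any MPGNN without positional encodings: for any constant initial representation `c`, any
update functions, and any layer `ℓ ∈ {0,…,n}`, the multisets of node representations coincide,
and hence every pooled graph representation `F({{h(v)}})` coincides as well. -/
theorem mpgnn_cannot_distinguish_cycle_six_from_two_triangles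
    {X : Type*} (c : X) (n : ℕ) (f : ℕ → X × Multiset X → X) :
    (∀ ℓ ≤ n,
      (Finset.univ : Finset (Fin 6)).val.map (mpgnn (cycleGraph 6) (fun _ => c) f ℓ) =
        (Finset.univ : Finset (Fin 3 ⊕ Fin 3)).val.map
          (mpgnn (cycleGraph 3 ⊕g cycleGraph 3) (fun _ => c) f ℓ)) ∧
    (∀ (Z : Type*) (F : Multiset X → Z),
      F ((Finset.univ : Finset (Fin 6)).val.map (mpgnn (cycleGraph 6) (fun _ => c) f n)) =
        F ((Finset.univ : Finset (Fin 3 ⊕ Fin 3)).val.map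
          (mpgnn (cycleGraph 3 ⊕g cycleGraph 3) (fun _ => c) f n))) := by
  have key := map_mpgnn_eq_of_isRegularOfDegree (isRegularOfDegree_cycleGraph 3)
    (isRegularOfDegree_sum (isRegularOfDegree_cycleGraph 0) (isRegularOfDegree_cycleGraph 0))
    rfl c f
  exact ⟨fun ℓ _ => key ℓ, fun _ F => congrArg F (key n)⟩
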